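/- Let f : 2^V → ℝ be a non-negative, monotone, submodular set function with f(∅) = 0 on a finite ground set V, and let k ≥ 1. Let G_k be the value obtained by the greedy algorithm that iteratively adds the element with maximum marginal gain for k steps, and let OPT_k = max{f(S) : |S| ≤ k}. Then G_k ≥ (1 − (1 − 1/k)^k) · OPT_k. -/

import Mathlib

theorem greedy_aux {V : Type*} [DecidableEq V] (f : Finset V → ℝ)
    (hmono : ∀ A B : Finset V, A ⊆ B → f A ≤ f B)
    (hsub : ∀ A B : Finset V, f (A ∪ B) + f (A ∩ B) ≤ f A + f B)
    (A : Finset V) (d : ℝ) (hd : ∀ x, f (insert x A) ≤ f A + d) (T : Finset V) :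
    f (A ∪ T) ≤ f A + T.card * d := by
  induction T using Finset.induction_on with
  | empty => simp
  | insert x T hx ih =>
    have h1 := hsub (A ∪ T) (insert x A)
    have h2 : (A ∪ T) ∪ insert x A = A ∪ insert x T := by
      ext y; simp only [Finset.mem_union, Finset.mem_insert]; tauto
    have h3 : f A ≤ f ((A ∪ T) ∩ insert x A) := hmono _ _ (by
      intro y hy; simp [hy])
    have h4 := hd x
    rw [h2] at h1
    rw [Finset.card_insert_of_notMem hx]
    push_cast
    linarith

/-- Greedy guarantee of Nemhauser–Wolsey–Fisher: for a non-negative, monotone, submodular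
set function `f` with `f ∅ = 0` on a finite ground set, the greedy sequence `S` (each step
adding an element of maximum marginal gain) satisfies
`f (S k) ≥ (1 - (1 - 1/k)^k) · OPT_k`. -/
theorem greedy_submodular_approx {V : Type*} [Fintype V] [DecidableEq V]
    (f : Finset V → ℝ)
    (hnonneg : ∀ A, 0 ≤ f A)
    (hmono : ∀ A B : Finset V, A ⊆ B → f A ≤ f B)
    (hsub : ∀ A B : Finset V, f (A ∪ B) + f (A ∩ B) ≤ f A + f B)
    (hempty : f ∅ = 0)
    (k : ℕ) (hk : 1 ≤ k)
    (S : ℕ → Finset V)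
    (hS0 : S 0 = ∅)
    (hgreedy : ∀ j, ∃ e : V, S (j + 1) = insert e (S j) ∧
      ∀ x : V, f (insert x (S j)) ≤ f (S (j + 1)))
    (OPT : ℝ)
    (hOPTmax : ∀ T : Finset V, T.card ≤ k → f T ≤ OPT)
    (hOPTach : ∃ T : Finset V, T.card ≤ k ∧ f T = OPT) :
    (1 - (1 - 1 / (k : ℝ)) ^ k) * OPT ≤ f (S k) := by
  obtain ⟨T, hT, rfl⟩ := hOPTach
  have hk0 : (0 : ℝ) < k := by exact_mod_cast hk
  have hk1 : (1 : ℝ) ≤ k := by exact_mod_cast hk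
  have hc : 0 ≤ 1 - 1 / (k : ℝ) := by
    rw [sub_nonneg, div_le_one hk0]; exact hk1
  have step : ∀ j, f T - f (S (j + 1)) ≤ (1 - 1 / (k : ℝ)) * (f T - f (S j)) := by
    intro j
    obtain ⟨e, he, hmax⟩ := hgreedy j
    have hd : 0 ≤ f (S (j + 1)) - f (S j) := by
      rw [sub_nonneg, he]; exact hmono _ _ (Finset.subset_insert _ _)
    have h1 := greedy_aux f hmono hsub (S j) (f (S (j + 1)) - f (S j))
      (fun x => by linarith [hmax x]) T
    have h2 := hmono T (S j ∪ T) Finset.subset_union_right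
    have h3 : (T.card : ℝ) * (f (S (j + 1)) - f (S j)) ≤ k * (f (S (j + 1)) - f (S j)) :=
      mul_le_mul_of_nonneg_right (by exact_mod_cast hT) hd
    have h4 : (f T - f (S j)) / k ≤ f (S (j + 1)) - f (S j) := by
      rw [div_le_iff₀ hk0]; linarith
    have h5 : (1 - 1 / (k : ℝ)) * (f T - f (S j)) = (f T - f (S j)) - (f T - f (S j)) / k := by
      ring
    linarith
  have main : ∀ j, f T - f (S j) ≤ (1 - 1 / (k : ℝ)) ^ j * f T := by
    intro j
    induction j with
    | zero => simp [hS0, hempty]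
    | succ j ih =>
      have := mul_le_mul_of_nonneg_left ih hc
      rw [pow_succ']
      linarith [step j]
  linarith [main k]
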